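/- Let G be a group of order 2 (e.g. Multiplicative (ZMod 2)) and let M be the ℤ-linear representation of G on ℤ/4 in which the nontrivial element of G acts by negation x ↦ −x. Then for every natural number n, the n-th group cohomology Hⁿ(G; M) is isomorphic as an abelian group to ℤ/2. -/

import Mathlib

open Multiplicative

/-- The ℤ-linear representation of the group `ℤ₂` (written multiplicatively) on `ℤ/4` in which
the nontrivial element acts by negation `x ↦ −x`. -/
def negationRep : Representation ℤ (Multiplicative (ZMod 2)) (ZMod 4) where
  toFun g := if toAdd g = 0 then 1 else -1
  map_one' := by simp
  map_mul' g h := by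
    have key : ∀ a : ZMod 2, a = 0 ∨ a = 1 := by decide
    rcases key (toAdd g) with hg | hg <;> rcases key (toAdd h) with hh | hh <;>
      simp [toAdd_mul, hg, hh, show ((1 : ZMod 2) + 1) = 0 by decide]


theorem aux_two {K H : Type*} [AddCommGroup H] (f : K → H) (hf : Function.Surjective f)
    (a : K) (ha : f a ≠ 0) (h : ∀ x, f x = 0 ∨ f x = f a) : Nonempty (H ≃+ ZMod 2) := by
  have hc : Nat.card H = 2 := by
    rw [Nat.card_eq_two_iff]
    refine ⟨0, f a, ha.symm, ?_⟩
    ext y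
    obtain ⟨x, rfl⟩ := hf y
    simpa using h x
  have : Fact (Nat.Prime 2) := ⟨Nat.prime_two⟩
  exact ⟨addEquivOfPrimeCardEq (p := 2) hc (by simp)⟩

theorem aux_gen : ∀ x : Multiplicative (ZMod 2), x ∈ Subgroup.zpowers (ofAdd (1 : ZMod 2)) := by
  intro x
  have key : ∀ a : ZMod 2, a = 0 ∨ a = 1 := by decide
  rcases key (toAdd x) with h | h
  · have : x = 1 := h
    rw [this]; exact one_mem _
  · have : x = ofAdd (1 : ZMod 2) := h
    rw [this]; exact Subgroup.mem_zpowers _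

theorem aux_epi {C : Type*} [CategoryTheory.Category C] {X Y : C} (e : CategoryTheory.Iso X Y) :
    CategoryTheory.Epi e.inv := inferInstance

theorem aux_one (x : ZMod 4) : negationRep 1 x = x := by simp

theorem aux_neg (x : ZMod 4) : negationRep (ofAdd (1 : ZMod 2)) x = -x := by
  simp [negationRep]

theorem aux_sub (x : ZMod 4) :
    (Rep.applyAsHom (Rep.of negationRep) (ofAdd (1 : ZMod 2)) -
      CategoryTheory.CategoryStruct.id (Rep.of negationRep)).hom.toLinearMap x = -x - x := by
  rw [← aux_neg]
  simp [Rep.sub_hom]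
  rfl

theorem aux_norm (x : ZMod 4) :
    (Rep.of negationRep).norm.hom.toLinearMap x = 0 := by
  have h : (Finset.univ : Finset (Multiplicative (ZMod 2))) = {1, ofAdd (1 : ZMod 2)} := by decide
  have h2 : (1 : Multiplicative (ZMod 2)) ≠ ofAdd (1 : ZMod 2) := by decide
  have : negationRep.norm x = 0 := by
    rw [Representation.norm, h, Finset.sum_pair h2, LinearMap.add_apply, aux_one, aux_neg]
    simp
  exact this

open Rep.FiniteCyclicGroup

/-- The twisted cohomology `Hⁿ(Bℤ₂; ℤ_{4,ρ}) = ℤ₂` in every degree `n`: for the group `ℤ₂`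
acting on `ℤ/4` by negation, the `n`-th group cohomology is isomorphic, as an abelian group,
to `ℤ/2` for every natural number `n`. -/
theorem groupCohomology_negation_rep (n : ℕ) :
    Nonempty ((groupCohomology (Rep.of negationRep) n) ≃+ ZMod 2) := by
  have hk : ∀ x : ZMod 4, -x - x = 0 → x = 0 ∨ x = 2 := by decide
  have h20 : (2 : ZMod 4) ≠ 0 := by decide
  have h2 : (2 : ZMod 4) ∈ LinearMap.ker (Rep.applyAsHom (Rep.of negationRep) (ofAdd (1 : ZMod 2)) -
      CategoryTheory.CategoryStruct.id (Rep.of negationRep)).hom.toLinearMap :=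
    (aux_sub 2).trans (by decide)
  rcases Nat.eq_zero_or_pos n with rfl | hn
  · let e := (groupCohomologyIso₀ (Rep.of negationRep) (ofAdd (1 : ZMod 2)) aux_gen).toLinearEquiv
    refine aux_two e.symm e.symm.surjective ⟨2, h2⟩ ?_ ?_
    · intro h
      rw [LinearEquiv.map_eq_zero_iff] at h
      exact h20 (congrArg Subtype.val h)
    · rintro ⟨x, hx⟩
      rcases hk x ((aux_sub x).symm.trans hx) with rfl | rfl
      · left; exact e.symm.map_zero
      · right; rfl
  have : NeZero n := ⟨hn.ne'⟩
  rcases Nat.even_or_odd n with he | ho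
  · refine aux_two (groupCohomologyπEven (Rep.of negationRep) (ofAdd (1 : ZMod 2)) aux_gen n he)
      ((ModuleCat.epi_iff_surjective _).1 (CategoryTheory.epi_comp'
        (aux_epi (CategoryTheory.ShortComplex.moduleCatCyclesIso _))
        (CategoryTheory.epi_comp' inferInstance inferInstance))) ⟨2, h2⟩ ?_ ?_
    · intro h
      obtain ⟨y, hy⟩ := (groupCohomologyπEven_eq_zero_iff _ _ _ _ _ _).1 h
      exact h20 (hy.symm.trans (aux_norm y))
    · rintro ⟨x, hx⟩
      rcases hk x ((aux_sub x).symm.trans hx) with rfl | rfl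
      · left; exact map_zero _
      · right; rfl
  · refine aux_two (groupCohomologyπOdd (Rep.of negationRep) (ofAdd (1 : ZMod 2)) aux_gen n ho)
      ((ModuleCat.epi_iff_surjective _).1 (CategoryTheory.epi_comp'
        (aux_epi (CategoryTheory.ShortComplex.moduleCatCyclesIso _))
        (CategoryTheory.epi_comp' inferInstance inferInstance))) ⟨(1 : ZMod 4), aux_norm 1⟩ ?_ ?_
    · intro h
      obtain ⟨y, hy⟩ := (groupCohomologyπOdd_eq_zero_iff _ _ _ _ _ _).1 h
      have : ∀ y : ZMod 4, -y - y ≠ 1 := by decide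
      exact this y ((aux_sub y).symm.trans hy)
    · rintro ⟨x, hx⟩
      have : ∀ x : ZMod 4, (∃ y, -y - y = x) ∨ (∃ y, -y - y = x - 1) := by decide
      rcases this x with ⟨y, hy⟩ | ⟨y, hy⟩
      · left
        exact (groupCohomologyπOdd_eq_zero_iff _ _ _ _ _ _).2 ⟨y, (aux_sub y).trans hy⟩
      · right
        exact (groupCohomologyπOdd_eq_iff _ _ _ _ _ _ _).2 ⟨y, (aux_sub y).trans hy⟩
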